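/- Let (Ω, 𝔽, μ) be a probability space with a filtration (ℱ_n)_{n∈ℕ}, and let x : ℕ → Ω → ℝ be an adapted sequence of nonnegative integrable random variables. Let φ > 0 be real and N ≥ 2 an integer, and suppose that for every n ≥ N the conditional expectation satisfies E[x_{n+1} | ℱ_n] ≤ (1 + φ/(n · log n)) · x_n almost surely. Then for every n ≥ N, E[x_n] ≤ exp(φ/(N · log N)) · (log n / log N)^φ · E[x_N]. -/

import Mathlib

open MeasureTheory Filter

/-- Discrete comparison of `1 / (t log t)` with its antiderivative `log log t`. -/
theorem one_div_mul_log_le_log_log_sub {n : ℝ} (hn : 1 < n) :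
    1 / ((n + 1) * Real.log (n + 1)) ≤ Real.log (Real.log (n + 1)) - Real.log (Real.log n) := by
  have hL : 0 < Real.log n := Real.log_pos hn
  have hL' : 0 < Real.log (n + 1) := Real.log_pos (by linarith)
  have hn0 : 0 < n := by linarith
  have hlog : 1 / (n + 1) ≤ Real.log (n + 1) - Real.log n := by
    have h := Real.one_sub_inv_le_log_of_pos (x := (n + 1) / n) (by positivity)
    rw [Real.log_div (by positivity) (by positivity)] at h
    convert h using 1
    field_simp
    ring
  have h := Real.one_sub_inv_le_log_of_pos (x := Real.log (n + 1) / Real.log n) (by positivity)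
  rw [Real.log_div (by positivity) (by positivity)] at h
  refine le_trans ?_ h
  calc 1 / ((n + 1) * Real.log (n + 1)) = 1 / (n + 1) / Real.log (n + 1) := by rw [div_div]
    _ ≤ (Real.log (n + 1) - Real.log n) / Real.log (n + 1) := by gcongr
    _ = 1 - (Real.log (n + 1) / Real.log n)⁻¹ := by field_simp

/-- An almost sure multiplicative bound on a conditional expectation passes to expectations. -/
theorem integral_le_mul_integral_of_condExp_le {Ω : Type*} {m 𝔽 : MeasurableSpace Ω}
    {μ : Measure Ω} [IsFiniteMeasure μ] (hm : m ≤ 𝔽) {f g : Ω → ℝ} {c : ℝ} (hg : Integrable g μ)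
    (h : μ[f|m] ≤ᵐ[μ] fun ω => c * g ω) : ∫ ω, f ω ∂μ ≤ c * ∫ ω, g ω ∂μ := by
  rw [← integral_condExp hm, ← integral_const_mul]
  exact integral_mono_ae integrable_condExp (hg.const_mul c) h

/-- Discrete Grönwall bound for the growth factors `1 + φ / (n log n)`. -/
theorem le_exp_mul_of_le_one_add_div_mul_log {a : ℕ → ℝ} (ha : ∀ n, 0 ≤ a n) {φ : ℝ} (hφ : 0 ≤ φ)
    {N : ℕ} (hN : 2 ≤ N)
    (h : ∀ n, N ≤ n → a (n + 1) ≤ (1 + φ / ((n : ℝ) * Real.log n)) * a n) {n : ℕ} (hn : N ≤ n) :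
    a n ≤ Real.exp (φ * (1 / ((N : ℝ) * Real.log N) - 1 / ((n : ℝ) * Real.log n)
      + (Real.log (Real.log n) - Real.log (Real.log N)))) * a N := by
  induction n, hn using Nat.le_induction with
  | base => simp
  | succ n hn ih =>
    have hn1 : (1 : ℝ) < n := by exact_mod_cast (by lia : 1 < n)
    have key := mul_le_mul_of_nonneg_left (one_div_mul_log_le_log_log_sub hn1) hφ
    calc a (n + 1) ≤ (1 + φ / ((n : ℝ) * Real.log n)) * a n := h n hn
      _ ≤ Real.exp (φ / ((n : ℝ) * Real.log n)) * a n := by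
        gcongr
        · exact ha n
        · rw [add_comm]
          exact Real.add_one_le_exp _
      _ ≤ _ := by
        refine (mul_le_mul_of_nonneg_left ih (Real.exp_nonneg _)).trans ?_
        rw [← mul_assoc, ← Real.exp_add]
        push_cast
        refine mul_le_mul_of_nonneg_right (Real.exp_le_exp.2 ?_) (ha N)
        rw [div_eq_mul_one_div φ ((n : ℝ) * Real.log n)]
        linarith

/-- Core recursive estimate of Theorem 2 (Appendix E): if `(x_n)` is an adapted sequence of
nonnegative integrable random variables on a filtered probability space with
`E[x_{n+1} | ℱ_n] ≤ (1 + φ/(n log n)) x_n` a.s. for all `n ≥ N` (with `φ > 0`, `N ≥ 2`),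
then `E[x_n] ≤ exp(φ/(N log N)) (log n / log N)^φ E[x_N]` for every `n ≥ N`. -/
theorem stmt11 {Ω : Type*} {𝔽 : MeasurableSpace Ω} {μ : Measure Ω} [IsProbabilityMeasure μ]
    (ℱ : Filtration ℕ 𝔽) (x : ℕ → Ω → ℝ) (hadapt : Adapted ℱ x)
    (hpos : ∀ n ω, 0 ≤ x n ω) (hint : ∀ n, Integrable (x n) μ)
    (φ : ℝ) (hφ : 0 < φ) (N : ℕ) (hN : 2 ≤ N)
    (hcond : ∀ n, N ≤ n →
      μ[x (n + 1)|ℱ n] ≤ᵐ[μ] fun ω => (1 + φ / ((n : ℝ) * Real.log n)) * x n ω) :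
    ∀ n, N ≤ n →
      ∫ ω, x n ω ∂μ ≤
        Real.exp (φ / ((N : ℝ) * Real.log N)) * (Real.log n / Real.log N) ^ φ *
          ∫ ω, x N ω ∂μ := by
  intro n hn
  have hlog : ∀ k, N ≤ k → 0 < Real.log k := fun k hk =>
    Real.log_pos (by exact_mod_cast (by lia : 1 < k))
  have hlogN := hlog N le_rfl
  have hlogn := hlog n hn
  have hN0 : 0 ≤ ∫ ω, x N ω ∂μ := integral_nonneg (hpos N)
  refine (le_exp_mul_of_le_one_add_div_mul_log (a := fun k => ∫ ω, x k ω ∂μ)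
    (fun k => integral_nonneg (hpos k)) hφ.le hN (fun k hk =>
      integral_le_mul_integral_of_condExp_le (ℱ.le k) (hint k) (hcond k hk)) hn).trans ?_
  rw [Real.rpow_def_of_pos (by positivity), Real.log_div hlogn.ne' hlogN.ne', ← Real.exp_add]
  refine mul_le_mul_of_nonneg_right (Real.exp_le_exp.2 ?_) hN0
  have hdrop : 0 ≤ φ * (1 / ((n : ℝ) * Real.log n)) := by positivity
  rw [div_eq_mul_one_div φ ((N : ℝ) * Real.log N)]
  linarith
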